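/- For all integers k, l ≥ 0, the even basis functions are orthonormal with respect to the weighted inner product: (1/(4π)) ∫_{-π}^{π} (d/dθ ẽ_k^{(e)}(θ)) (d/dθ ẽ_l^{(e)}(θ)) / sin²(θ/2) dθ = 1 if k = l and = 0 if k ≠ l. -/

import Mathlib

open Real intervalIntegral

/-- The even basis functions: `ẽ_0^{(e)}(θ) = cos θ − 1` and, for `l ≥ 1`,
`ẽ_l^{(e)}(θ) = (cos((l+1)θ) − 1)/(l+1) − (cos(lθ) − 1)/l`. -/
noncomputable def eEven (l : ℕ) : ℝ → ℝ :=
  fun θ =>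
    if l = 0 then Real.cos θ - 1
    else (Real.cos (((l : ℝ) + 1) * θ) - 1) / ((l : ℝ) + 1) -
      (Real.cos ((l : ℝ) * θ) - 1) / (l : ℝ)

theorem deriv_eEven (l : ℕ) (θ : ℝ) :
    deriv (eEven l) θ = -(2 * Real.cos (((l : ℝ) + 1 / 2) * θ) * Real.sin (θ / 2)) := by
  have h_cos (a : ℝ) : HasDerivAt (fun θ => Real.cos (a * θ) - 1) (-Real.sin (a * θ) * a) θ := by
    simpa using (((hasDerivAt_id θ).const_mul a).cos).sub_const 1
  have h_deriv : HasDerivAt (eEven l) (-Real.sin (((l : ℝ) + 1) * θ) + Real.sin (l * θ)) θ := by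
    rcases eq_or_ne l 0 with rfl | hl
    · have h_zero : eEven 0 = fun x => Real.cos (1 * x) - 1 := by
        funext x
        simp [eEven]
      rw [h_zero]
      simpa only [Nat.cast_zero, zero_add, zero_mul, Real.sin_zero, add_zero, mul_one] using h_cos 1
    · have hl' : (l : ℝ) ≠ 0 := Nat.cast_ne_zero.mpr hl
      have hl1 : (l : ℝ) + 1 ≠ 0 := Nat.cast_add_one_ne_zero l
      have h := ((h_cos (l + 1)).div_const ((l : ℝ) + 1)).sub ((h_cos l).div_const (l : ℝ))
      rw [mul_div_cancel_right₀ _ hl1, mul_div_cancel_right₀ _ hl', sub_neg_eq_add] at h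
      refine h.congr_of_eventuallyEq (Filter.Eventually.of_forall fun x => ?_)
      simp [eEven, hl]
  rw [h_deriv.deriv, show ((l : ℝ) + 1) * θ = ((l : ℝ) + 1 / 2) * θ + θ / 2 by ring,
    show (l : ℝ) * θ = ((l : ℝ) + 1 / 2) * θ - θ / 2 by ring, Real.sin_add, Real.sin_sub]
  ring

theorem integral_cos_int_mul (n : ℤ) :
    ∫ θ in (-Real.pi)..Real.pi, Real.cos (n * θ) = if n = 0 then 2 * Real.pi else 0 := by
  split_ifs with hn
  · simp [hn]
    ring
  · rw [integral_comp_mul_left (fun x => Real.cos x) (Int.cast_ne_zero.mpr hn), integral_cos]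
    simp [Real.sin_int_mul_pi]

theorem deriv_eEven_mul_deriv_eEven_div (k l : ℕ) {θ : ℝ} (hθ : Real.sin (θ / 2) ≠ 0) :
    deriv (eEven k) θ * deriv (eEven l) θ / Real.sin (θ / 2) ^ 2 =
      2 * (Real.cos (((k + l + 1 : ℤ) : ℝ) * θ) + Real.cos (((k - l : ℤ) : ℝ) * θ)) := by
  rw [deriv_eEven, deriv_eEven, div_eq_iff (pow_ne_zero 2 hθ)]
  push_cast
  rw [show ((k : ℝ) + l + 1) * θ = (k + 1 / 2) * θ + (l + 1 / 2) * θ by ring,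
    show ((k : ℝ) - l) * θ = (k + 1 / 2) * θ - (l + 1 / 2) * θ by ring,
    Real.cos_add, Real.cos_sub]
  ring

/-- Orthonormality of the even basis functions with respect to the weighted inner product
`⟨ξ, η⟩_g = (1/(4π)) ∫_{-π}^{π} ξ'(θ) η'(θ) / sin²(θ/2) dθ`. -/
theorem even_basis_orthonormal (k l : ℕ) :
    (1 / (4 * Real.pi)) *
      ∫ θ in (-Real.pi)..Real.pi,
        deriv (eEven k) θ * deriv (eEven l) θ / Real.sin (θ / 2) ^ 2 =
    if k = l then 1 else 0 := by
  have h_ae : ∀ᵐ θ : ℝ, θ ∈ Set.uIoc (-Real.pi) Real.pi →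
      deriv (eEven k) θ * deriv (eEven l) θ / Real.sin (θ / 2) ^ 2 =
        2 * (Real.cos (((k + l + 1 : ℤ) : ℝ) * θ) + Real.cos (((k - l : ℤ) : ℝ) * θ)) := by
    filter_upwards [MeasureTheory.Measure.ae_ne MeasureTheory.volume (0 : ℝ)] with θ hθ hmem
    rw [Set.uIoc_of_le (by linarith [Real.pi_pos])] at hmem
    refine deriv_eEven_mul_deriv_eEven_div k l fun hsin => hθ ?_
    have := (Real.sin_eq_zero_iff_of_lt_of_lt (by linarith [hmem.1, Real.pi_pos])
      (by linarith [hmem.2, Real.pi_pos])).mp hsin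
    linarith
  have h_int (n : ℤ) : IntervalIntegrable (fun θ => Real.cos (n * θ)) MeasureTheory.volume
      (-Real.pi) Real.pi := Continuous.intervalIntegrable (by fun_prop) _ _
  rw [integral_congr_ae h_ae, integral_const_mul, integral_add (h_int _) (h_int _),
    integral_cos_int_mul, integral_cos_int_mul, if_neg (by lia)]
  by_cases hkl : k = l
  · rw [if_pos (by lia), if_pos hkl]
    field_simp
    ring
  · rw [if_neg (by lia), if_neg hkl]
    simp
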